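/- Let 0 < r < R, n ≥ 3 an integer, and let H : [r,R] → ℝ be an absolutely continuous increasing function with H(r) = r⋆ > 0 and H(R) = R⋆ > r⋆, whose derivative satisfies Ḣ/H ∈ L^{n-1}(r,R). Then ∫_r^R t^{n-1} (Ḣ(t)/H(t))^{n-1} dt ≥ (log(R⋆/r⋆))^{n-1} / (n-2)^{n-2} · Rr / (R^{1/(n-2)} - r^{1/(n-2)})^{n-2}. -/

import Mathlib

open Real MeasureTheory intervalIntegral

/-- The graph of `x ↦ x ^ (m + 1)` lies above its tangent line at `y` on the nonnegative reals. -/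
lemma tangent_line_le_pow_succ {x y : ℝ} (hx : 0 ≤ x) (hy : 0 ≤ y) (m : ℕ) :
    (m + 1) * (y ^ m * x) - m * y ^ (m + 1) ≤ x ^ (m + 1) := by
  induction m with
  | zero => simp
  | succ m ih =>
    have h1 := mul_le_mul_of_nonneg_right ih hx
    have h2 : 0 ≤ (m + 1 : ℝ) * (y ^ m * (x - y) ^ 2) := by positivity
    rw [pow_succ x (m + 1)]
    refine le_trans (le_of_sub_nonneg ?_) h1
    refine h2.trans (le_of_eq ?_)
    push_cast
    ring

lemma HasDerivAt.nonneg_of_monotoneOn_Icc {f : ℝ → ℝ} {f' a b t : ℝ} (hab : a < b)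
    (ht : t ∈ Set.Icc a b) (hf : HasDerivAt f f' t) (hmono : MonotoneOn f (Set.Icc a b)) :
    0 ≤ f' := by
  rw [← hf.hasDerivWithinAt.derivWithin (uniqueDiffOn_Icc hab t ht)]
  exact hmono.derivWithin_nonneg

/-- The weighted Hölder inequality for the weight `t ^ (m + 1)`, in terms of
`c = L / ∫ t ^ (-(1 / m) - 1)` where `L = ∫ u`. -/
lemma pow_mul_integral_le_integral_pow_mul_pow {m : ℕ} (hm : m ≠ 0) {r R c : ℝ}
    (hr : 0 < r) (hrR : r < R) (hc : 0 ≤ c) {u : ℝ → ℝ}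
    (hu0 : ∀ t ∈ Set.Icc r R, 0 ≤ u t) (hu : IntervalIntegrable u volume r R)
    (hup : IntervalIntegrable (fun t => |u t| ^ (m + 1)) volume r R)
    (hcu : c * ∫ t in r..R, t ^ (-(1 / (m : ℝ)) - 1) = ∫ t in r..R, u t) :
    c ^ m * ∫ t in r..R, u t ≤ ∫ t in r..R, t ^ (m + 1) * u t ^ (m + 1) := by
  have hpos : ∀ t ∈ Set.uIcc r R, 0 < t := fun t ht =>
    hr.trans_le (Set.uIcc_of_le hrR.le ▸ ht).1
  have hv : IntervalIntegrable (fun t : ℝ => t ^ (-(1 / (m : ℝ)) - 1)) volume r R :=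
    (ContinuousOn.rpow_const continuousOn_id fun t ht =>
      Or.inl (hpos t ht).ne').intervalIntegrable
  have hw : IntervalIntegrable (fun t => t ^ (m + 1) * u t ^ (m + 1)) volume r R := by
    refine (hup.congr fun t ht => ?_).continuousOn_mul (continuous_pow _).continuousOn
    simp only [abs_of_nonneg (hu0 t (Set.uIcc_of_le hrR.le ▸ Set.uIoc_subset_uIcc ht))]
  have hpt : ∀ t ∈ Set.Icc r R,
      (m + 1) * c ^ m * u t - m * c ^ (m + 1) * t ^ (-(1 / (m : ℝ)) - 1) ≤
        t ^ (m + 1) * u t ^ (m + 1) := by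
    intro t ht
    have ht0 : 0 < t := hr.trans_le ht.1
    have hs : (t ^ (-(1 / (m : ℝ)))) ^ m = t⁻¹ := by
      rw [← rpow_mul_natCast ht0.le, neg_mul, one_div_mul_cancel (Nat.cast_ne_zero.mpr hm),
        rpow_neg_one]
    have hs1 : t ^ (-(1 / (m : ℝ)) - 1) = (t ^ (-(1 / (m : ℝ)))) ^ (m + 1) := by
      rw [pow_succ, hs, rpow_sub_one ht0.ne', div_eq_inv_mul]
    have h := tangent_line_le_pow_succ (mul_nonneg ht0.le (hu0 t ht))
      (mul_nonneg hc (rpow_nonneg ht0.le (-(1 / (m : ℝ))))) m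
    rw [mul_pow c, mul_pow c, mul_pow t, ← hs1, hs] at h
    refine le_trans (le_of_eq ?_) h
    field_simp
  have hmon := integral_mono_on hrR.le
    ((hu.const_mul ((m + 1) * c ^ m)).sub (hv.const_mul (m * c ^ (m + 1)))) hw hpt
  rw [integral_sub (hu.const_mul _) (hv.const_mul _), intervalIntegral.integral_const_mul,
    intervalIntegral.integral_const_mul] at hmon
  refine le_trans (le_of_eq ?_) hmon
  rw [← hcu]
  ring

theorem stmt_7 (n : ℕ) (hn : 3 ≤ n) (r R rs Rs : ℝ)
    (hr : 0 < r) (hrR : r < R) (hrs : 0 < rs) (hRs : rs < Rs)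
    (H H' : ℝ → ℝ)
    (hderiv : ∀ t ∈ Set.Icc r R, HasDerivAt H (H' t) t)
    (hmono : MonotoneOn H (Set.Icc r R))
    (hHr : H r = rs) (hHR : H R = Rs)
    (hL : IntervalIntegrable (fun t => |H' t / H t| ^ (n - 1)) volume r R)
    (hFTC : ∫ t in r..R, H' t / H t = Real.log (Rs / rs)) :
    (Real.log (Rs / rs)) ^ (n - 1) / ((n : ℝ) - 2) ^ (n - 2) *
        (R * r / (R ^ (1 / ((n : ℝ) - 2)) - r ^ (1 / ((n : ℝ) - 2))) ^ (n - 2)) ≤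
      ∫ t in r..R, t ^ (n - 1) * (H' t / H t) ^ (n - 1) := by
  obtain ⟨m, rfl⟩ : ∃ m, n = m + 2 := ⟨n - 2, by omega⟩
  have hm : m ≠ 0 := by omega
  have hm0 : (0 : ℝ) < m := by positivity
  have hR : 0 < R := hr.trans hrR
  simp only [Nat.add_sub_cancel, show m + 2 - 1 = m + 1 from rfl,
    show ((m + 2 : ℕ) : ℝ) - 2 = m by push_cast; ring] at hL ⊢
  have hlog : 0 < log (Rs / rs) := log_pos ((one_lt_div hrs).mpr hRs)
  have hu : IntervalIntegrable (fun t => H' t / H t) volume r R := by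
    by_contra h
    exact hlog.ne' (hFTC ▸ integral_undef h)
  have hu0 : ∀ t ∈ Set.Icc r R, 0 ≤ H' t / H t := fun t ht =>
    div_nonneg ((hderiv t ht).nonneg_of_monotoneOn_Icc hrR ht hmono)
      (hrs.le.trans (hHr ▸ hmono (Set.left_mem_Icc.mpr hrR.le) ht ht.1))
  have hd : 0 < R ^ (1 / (m : ℝ)) - r ^ (1 / (m : ℝ)) :=
    sub_pos.mpr (rpow_lt_rpow hr.le hrR (by positivity))
  have hrpos : 0 < r ^ (1 / (m : ℝ)) := rpow_pos_of_pos hr _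
  have hRpos : 0 < R ^ (1 / (m : ℝ)) := rpow_pos_of_pos hR _
  have hrm : (r ^ (1 / (m : ℝ))) ^ m = r := by
    rw [one_div, rpow_inv_natCast_pow hr.le hm]
  have hRm : (R ^ (1 / (m : ℝ))) ^ m = R := by
    rw [one_div, rpow_inv_natCast_pow hR.le hm]
  have hI : ∫ t in r..R, t ^ (-(1 / (m : ℝ)) - 1) =
      m * (R ^ (1 / (m : ℝ)) - r ^ (1 / (m : ℝ))) /
        (R ^ (1 / (m : ℝ)) * r ^ (1 / (m : ℝ))) := by
    rw [integral_rpow (Or.inr ⟨fun h => (one_div_pos.mpr hm0).ne' (by linarith),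
      Set.notMem_uIcc_of_lt hr hR⟩), sub_add_cancel, rpow_neg hr.le, rpow_neg hR.le]
    generalize r ^ (1 / (m : ℝ)) = a at *
    generalize R ^ (1 / (m : ℝ)) = b at *
    field_simp
    ring
  set a := r ^ (1 / (m : ℝ))
  set b := R ^ (1 / (m : ℝ))
  have key := pow_mul_integral_le_integral_pow_mul_pow hm hr hrR
    (c := log (Rs / rs) * (b * a) / (m * (b - a))) (by positivity) hu0 hu hL (by
      rw [hI, hFTC]
      field_simp)
  refine le_trans (le_of_eq ?_) key
  rw [hFTC, div_pow, mul_pow, mul_pow, mul_pow, hrm, hRm, pow_succ]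
  field_simp
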